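/- arXiv:1010.2433 — 4 statements merged into one kernel-verified Lean document; each statement's English description precedes it below -/
import Mathlib

section
/- Let the 1-to-K broadcast PEC be spatially independent with marginal success probabilities 0 < p_1 ≤ p_2 ≤ ... ≤ p_K ≤ 1, and let (R_1,...,R_K) be a one-sidedly fair vector of nonnegative reals. Then (R_1,...,R_K) satisfies the outer-bound inequality ∑_{j=1}^K R_{π(j)}/p_{∪S_j^π} ≤ 1 for every permutation π of [K] if and only if it satisfies the single inequality ∑_{k=1}^K R_k/(1 − ∏_{l=1}^k (1−p_l)) ≤ 1. -/
open Finset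

/-- `pCup p S` is the probability that at least one receiver in `S` receives the packet:
the sum of `p S'` over all `S'` intersecting `S`. -/
def pCup {K : ℕ} (p : Finset (Fin K) → ℝ) (S : Finset (Fin K)) : ℝ :=
  ∑ S' ∈ Finset.univ.filter (fun S' : Finset (Fin K) => (S' ∩ S).Nonempty), p S'

/-- For independent receivers, some receiver in `S` is reached with probability
`1 - ∏ k ∈ S, (1 - q k)`. -/
lemma pCup_eq_one_sub_prod {K : ℕ} (p : Finset (Fin K) → ℝ) (q : Fin K → ℝ)
    (hind : ∀ S : Finset (Fin K), p S = (∏ k ∈ S, q k) * ∏ k ∈ Sᶜ, (1 - q k))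
    (S : Finset (Fin K)) : pCup p S = 1 - ∏ k ∈ S, (1 - q k) := by
  have htotal : ∑ T : Finset (Fin K), p T = 1 := by
    have h := Finset.prod_add q (fun k => 1 - q k) Finset.univ
    simp only [add_sub_cancel, Finset.prod_const_one, Finset.powerset_univ] at h
    simp only [hind, Finset.compl_eq_univ_sdiff]
    exact h.symm
  have hmiss : ∑ T ∈ Finset.univ.filter (fun T : Finset (Fin K) => ¬ (T ∩ S).Nonempty), p T
      = ∏ k ∈ S, (1 - q k) := by
    have h := Finset.prod_add (fun k => if k ∈ S then 0 else q k) (fun k => 1 - q k) Finset.univ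
    have hleft : ∏ k, ((if k ∈ S then 0 else q k) + (1 - q k)) = ∏ k ∈ S, (1 - q k) := by
      rw [← Finset.prod_filter_mul_prod_filter_not Finset.univ (· ∈ S)]
      rw [Finset.prod_congr (g := fun k => 1 - q k) rfl (by simp +contextual),
        Finset.prod_congr (s₁ := Finset.univ.filter (· ∉ S)) (g := fun _ => 1) rfl
          (by simp +contextual)]
      simp
    rw [← hleft, h, Finset.powerset_univ, Finset.sum_filter]
    refine Finset.sum_congr rfl fun T _ => ?_
    split_ifs with hT
    · obtain ⟨k, hk⟩ := hT
      rw [Finset.mem_inter] at hk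
      rw [Finset.prod_eq_zero (f := fun i => if i ∈ S then 0 else q i) hk.1 (if_pos hk.2),
        zero_mul]
    · rw [hind, Finset.compl_eq_univ_sdiff]
      congr 1
      refine Finset.prod_congr rfl fun k hk => ?_
      rw [if_neg fun hkS => hT ⟨k, Finset.mem_inter.2 ⟨hk, hkS⟩⟩]
  have hsplit := Finset.sum_filter_add_sum_filter_not Finset.univ
    (fun T : Finset (Fin K) => (T ∩ S).Nonempty) p
  rw [hmiss, htotal] at hsplit
  unfold pCup
  linarith

/-- The left-hand side of the outer-bound inequality for receivers visited in the order of a list,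
where `x` gives the erasure probabilities and `P` is the erasure probability of the receivers
visited beforehand. -/
noncomputable def outerSum {ι : Type*} (R x : ι → ℝ) : ℝ → List ι → ℝ
  | _, [] => 0
  | P, a :: l => R a / (1 - P * x a) + outerSum R x (P * x a) l

lemma sum_div_eq_outerSum {ι : Type*} (R x : ι → ℝ) {n : ℕ} (σ : Fin n → ι) (P : ℝ) :
    ∑ j : Fin n, R (σ j) / (1 - P * ∏ i ∈ Finset.univ.filter (fun i => i ≤ j), x (σ i))
      = outerSum R x P (List.ofFn σ) := by
  induction n generalizing P with
  | zero => simp [outerSum]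
  | succ n ih =>
    rw [List.ofFn_succ, outerSum, ← ih, Fin.sum_univ_succ]
    simp [Finset.prod_filter, Fin.prod_univ_succ, mul_assoc]

lemma div_add_div_swap_le {P a b u v : ℝ} (hP0 : 0 ≤ P) (hP1 : P ≤ 1) (hb0 : 0 ≤ b)
    (hba : b ≤ a) (ha1 : a < 1) (hu : 0 ≤ u) (hfair : v * b ≤ u * a) :
    v / (1 - P * b) + u / (1 - P * b * a) ≤ u / (1 - P * a) + v / (1 - P * a * b) := by
  have ha0 : 0 ≤ a := hb0.trans hba
  have hA : 0 < 1 - P * a := by nlinarith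
  have hB : 0 < 1 - P * b := by nlinarith
  have hC : 0 < 1 - P * a * b := by nlinarith [mul_nonneg hP0 ha0]
  have hfactor : (1 - a) * (1 - P * a) ≤ (1 - b) * (1 - P * b) :=
    mul_le_mul (by linarith) (by nlinarith) hA.le (by linarith)
  have hkey : v * b * ((1 - a) * (1 - P * a)) ≤ u * a * ((1 - b) * (1 - P * b)) :=
    mul_le_mul hfair hfactor (mul_nonneg (by linarith) hA.le) (mul_nonneg hu ha0)
  have hdiff : u / (1 - P * a) + v / (1 - P * a * b)
      - (v / (1 - P * b) + u / (1 - P * b * a))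
      = P * (u * a * ((1 - b) * (1 - P * b)) - v * b * ((1 - a) * (1 - P * a)))
        / ((1 - P * a) * (1 - P * b) * (1 - P * a * b)) := by
    rw [mul_right_comm P b a]
    field_simp
    ring
  have hnonneg : 0 ≤ P * (u * a * ((1 - b) * (1 - P * b)) - v * b * ((1 - a) * (1 - P * a)))
        / ((1 - P * a) * (1 - P * b) * (1 - P * a * b)) :=
    div_nonneg (mul_nonneg hP0 (sub_nonneg.2 hkey)) (by positivity)
  linarith

section Sorting

variable {ι : Type*} [LinearOrder ι] {R x : ι → ℝ}

lemma outerSum_cons_le_orderedInsert (hx0 : ∀ i, 0 ≤ x i) (hx1 : ∀ i, x i < 1)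
    (hanti : Antitone x) (hR : ∀ i, 0 ≤ R i)
    (hfair : ∀ i j, i < j → R j * x j ≤ R i * x i) (a : ι) (l : List ι) {P : ℝ}
    (hP0 : 0 ≤ P) (hP1 : P ≤ 1) :
    outerSum R x P (a :: l) ≤ outerSum R x P (l.orderedInsert (· ≤ ·) a) := by
  induction l generalizing P with
  | nil => simp
  | cons b l ih =>
    rw [List.orderedInsert_cons]
    split_ifs with hab
    · rfl
    · have hba := not_le.1 hab
      have hswap := div_add_div_swap_le hP0 hP1 (hx0 a) (hanti hba.le) (hx1 b) (hR b)
        (hfair b a hba)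
      have hrec := ih (P := P * x b) (mul_nonneg hP0 (hx0 b))
        (mul_le_one₀ hP1 (hx0 b) (hx1 b).le)
      simp only [outerSum] at hrec ⊢
      rw [mul_right_comm P (x a) (x b)] at hswap ⊢
      linarith

lemma outerSum_le_insertionSort (hx0 : ∀ i, 0 ≤ x i) (hx1 : ∀ i, x i < 1)
    (hanti : Antitone x) (hR : ∀ i, 0 ≤ R i)
    (hfair : ∀ i j, i < j → R j * x j ≤ R i * x i) (l : List ι) {P : ℝ}
    (hP0 : 0 ≤ P) (hP1 : P ≤ 1) :
    outerSum R x P l ≤ outerSum R x P (l.insertionSort (· ≤ ·)) := by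
  induction l generalizing P with
  | nil => simp
  | cons a l ih =>
    have hrec := ih (P := P * x a) (mul_nonneg hP0 (hx0 a)) (mul_le_one₀ hP1 (hx0 a) (hx1 a).le)
    refine le_trans ?_ (outerSum_cons_le_orderedInsert hx0 hx1 hanti hR hfair a _ hP0 hP1)
    exact add_le_add_right hrec _

end Sorting

lemma insertionSort_ofFn_perm {n : ℕ} (π : Equiv.Perm (Fin n)) :
    (List.ofFn π).insertionSort (· ≤ ·) = List.ofFn id := by
  refine List.Perm.eq_of_pairwise' (r := (· ≤ ·)) (List.pairwise_insertionSort _ _) ?_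
    ((List.perm_insertionSort _ _).trans ?_)
  · exact List.pairwise_ofFn.2 fun _ _ h => h.le
  · exact Equiv.Perm.ofFn_comp_perm π id

/-- For a spatially independent 1-to-K broadcast PEC with marginal success probabilities
`0 < q 1 ≤ q 2 ≤ ... ≤ q K ≤ 1` and a one-sidedly fair nonnegative rate vector `R`,
the vector `R` satisfies all `K!` outer-bound inequalities iff it satisfies the single
inequality `∑_{k=1}^K R_k/(1 − ∏_{l=1}^k (1−q l)) ≤ 1`. -/
theorem stmt8 (K : ℕ) (p : Finset (Fin K) → ℝ) (q : Fin K → ℝ)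
    (hq0 : ∀ k, 0 < q k) (hq1 : ∀ k, q k ≤ 1)
    (hmono : ∀ i j : Fin K, i ≤ j → q i ≤ q j)
    (hind : ∀ S : Finset (Fin K),
      p S = (∏ k ∈ S, q k) * ∏ k ∈ Sᶜ, (1 - q k))
    (R : Fin K → ℝ) (hR : ∀ k, 0 ≤ R k)
    (hosf : ∀ i j : Fin K, i ≠ j → q i ≤ q j → R j * (1 - q j) ≤ R i * (1 - q i)) :
    (∀ π : Equiv.Perm (Fin K),
        ∑ j : Fin K,
          R (π j) / pCup p ((Finset.univ.filter (fun i : Fin K => i ≤ j)).image π) ≤ 1)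
      ↔ ∑ k : Fin K,
          R k / (1 - ∏ l ∈ Finset.univ.filter (fun l : Fin K => l ≤ k), (1 - q l)) ≤ 1 := by
  have hcup (π : Equiv.Perm (Fin K)) :
      ∑ j : Fin K, R (π j) / pCup p ((Finset.univ.filter (fun i : Fin K => i ≤ j)).image π)
        = outerSum R (fun k => 1 - q k) 1 (List.ofFn π) := by
    rw [← sum_div_eq_outerSum]
    refine Finset.sum_congr rfl fun j _ => ?_
    rw [pCup_eq_one_sub_prod p q hind, Finset.prod_image π.injective.injOn, one_mul]
  have hid : ∑ k : Fin K,
      R k / (1 - ∏ l ∈ Finset.univ.filter (fun l : Fin K => l ≤ k), (1 - q l))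
        = outerSum R (fun k => 1 - q k) 1 (List.ofFn id) := by
    simp [← sum_div_eq_outerSum]
  simp only [hcup, hid]
  refine ⟨fun h => h 1, fun h π => le_trans ?_ h⟩
  rw [← insertionSort_ofFn_perm π]
  exact outerSum_le_insertionSort (fun k => sub_nonneg.2 (hq1 k))
    (fun k => sub_lt_self 1 (hq0 k)) (fun i j hij => sub_le_sub_left (hmono i j hij) 1) hR
    (fun i j hij => hosf i j hij.ne (hmono i j hij.le)) _ zero_le_one le_rfl
end

section
/- Let K be a positive integer and consider a 1-to-K broadcast PEC with parameters p_S (S ⊆ [K]) such that p_k > 0 for every k ∈ [K]. Let (R_1,...,R_K) be a vector of nonnegative reals and let ≺ be a cardinality-compatible strict total order on the subsets of [K]. If there exist LP-feasible variables for (R_1,...,R_K) with respect to ≺, then (R_1,...,R_K) satisfies the outer-bound inequalities ∑_{j=1}^K R_{π(j)}/p_{∪S_j^π} ≤ 1 for every permutation π of [K]. (In other words, the inner-bound region of the linear program is contained in the outer-bound region.) -/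
open Finset
open scoped Classical

/-- `fp p S T` is the probability that the packet is received by all receivers in `S`
and by none in `T`: the sum of `p S₁` over all `S₁` with `S ⊆ S₁ ⊆ [K]∖T`. -/
def fp {K : ℕ} (p : Finset (Fin K) → ℝ) (S T : Finset (Fin K)) : ℝ :=
  ∑ S1 ∈ Finset.univ.filter (fun S1 : Finset (Fin K) => S ⊆ S1 ∧ S1 ⊆ Finset.univ \ T), p S1

/-- A strict total order `ord` on the subsets of `[K]` is cardinality-compatible if
`|S₁| < |S₂|` implies `ord S₁ S₂`. -/
def CardCompatible {K : ℕ} (ord : Finset (Fin K) → Finset (Fin K) → Prop) : Prop :=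
  IsStrictTotalOrder (Finset (Fin K)) ord ∧
    ∀ S1 S2 : Finset (Fin K), S1.card < S2.card → ord S1 S2

/-- The variables `x S` (for `S ⊆ [K]`) and `w k S T` (for `k ∈ [K]`, `T ⊆ S ⊆ [K]∖{k}`)
are LP-feasible for the rate vector `R` with respect to the cardinality-compatible strict
total order `ord`: they are nonnegative and satisfy the inequalities (4)-(8) of the
inner-bound linear program. -/
def LPFeasible {K : ℕ} (p : Finset (Fin K) → ℝ) (R : Fin K → ℝ)
    (ord : Finset (Fin K) → Finset (Fin K) → Prop)
    (x : Finset (Fin K) → ℝ)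
    (w : Fin K → Finset (Fin K) → Finset (Fin K) → ℝ) : Prop :=
  -- nonnegativity of the `x` variables
  (∀ S : Finset (Fin K), 0 ≤ x S) ∧
  -- nonnegativity of the `w` variables
  (∀ k : Fin K, ∀ S T : Finset (Fin K), T ⊆ S → S ⊆ Finset.univ \ {k} → 0 ≤ w k S T) ∧
  -- (i): ∑_S x_S < 1
  (∑ S : Finset (Fin K), x S < 1) ∧
  -- (ii): for every T ⊆ [K] and k ∈ T
  (∀ T : Finset (Fin K), ∀ k ∈ T,
      x T ≥ ∑ S ∈ Finset.univ.filter
          (fun S : Finset (Fin K) => T \ {k} ⊆ S ∧ S ⊆ Finset.univ \ {k}),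
        w k S (T \ {k})) ∧
  -- (iii): w_{k;∅→∅}·p_{∪[K]} ≥ R_k
  (∀ k : Fin K, w k ∅ ∅ * pCup p Finset.univ ≥ R k) ∧
  -- (iv): for every k and nonempty S ⊆ [K]∖{k}
  (∀ k : Fin K, ∀ S : Finset (Fin K), S ⊆ Finset.univ \ {k} → S.Nonempty →
      (∑ T1 ∈ S.powerset, w k S T1) * pCup p (Finset.univ \ S) ≥
        ∑ ST ∈ (Finset.univ : Finset (Finset (Fin K) × Finset (Fin K))).filter
            (fun ST => ST.2 ⊆ ST.1 ∧ ST.1 ⊆ Finset.univ \ {k} ∧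
              ST.2 ⊆ S ∧ ¬ S ⊆ ST.1),
          w k ST.1 ST.2 * fp p (S \ ST.2) (Finset.univ \ S)) ∧
  -- (v): for every k and T ⊊ S ⊆ [K]∖{k}
  (∀ k : Fin K, ∀ S T : Finset (Fin K), T ⊆ S → S ⊆ Finset.univ \ {k} → T ≠ S →
      (w k S T +
          ∑ T1 ∈ S.powerset.filter (fun T1 => ord (insert k T1) (insert k T)), w k S T1)
        * pCup p (Finset.univ \ S) ≤
      (∑ S1 ∈ Finset.univ.filter
          (fun S1 : Finset (Fin K) => ord S1 S ∧ T ⊆ S1 ∧ S1 ⊆ Finset.univ \ {k}),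
        w k S1 T * fp p (S \ T) (Finset.univ \ S)) +
      ∑ ST ∈ (Finset.univ : Finset (Finset (Fin K) × Finset (Fin K))).filter
          (fun ST => ST.2 ⊆ ST.1 ∧ ST.1 ⊆ Finset.univ \ {k} ∧
            ord (insert k ST.2) (insert k T) ∧ ST.2 ⊆ S ∧ ¬ S ⊆ ST.1),
        w k ST.1 ST.2 * fp p (S \ ST.2) (Finset.univ \ S))

/-- `pCup p Sᶜ` is the probability that the set of receivers is not contained in `S`. -/
lemma pCup_compl_eq {K : ℕ} (p : Finset (Fin K) → ℝ) (S : Finset (Fin K)) :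
    pCup p (Finset.univ \ S) = ∑ Q : Finset (Fin K), if Q ⊆ S then 0 else p Q := by
  unfold pCup
  rw [Finset.sum_filter]
  refine Finset.sum_congr rfl fun Q _ => ?_
  have h : (Q ∩ (Finset.univ \ S)).Nonempty ↔ ¬ Q ⊆ S := by
    simp only [Finset.Nonempty, Finset.mem_inter, Finset.mem_sdiff, Finset.mem_univ, true_and,
      Finset.not_subset]
  by_cases hQ : Q ⊆ S <;> simp [h, hQ]

/-- For `T ⊆ S`, `fp p (S \ T) Sᶜ` is the probability that the set of receivers, joined
with `T`, is exactly `S`. -/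
lemma fp_sdiff_compl_eq {K : ℕ} (p : Finset (Fin K) → ℝ) {S T : Finset (Fin K)} (hT : T ⊆ S) :
    fp p (S \ T) (Finset.univ \ S) = ∑ Q : Finset (Fin K), if T ∪ Q = S then p Q else 0 := by
  unfold fp
  rw [Finset.sum_filter]
  refine Finset.sum_congr rfl fun Q _ => ?_
  have h : (S \ T ⊆ Q ∧ Q ⊆ Finset.univ \ (Finset.univ \ S)) ↔ T ∪ Q = S := by
    constructor
    · rintro ⟨h1, h2⟩
      ext a
      have h1a := @h1 a
      have h2a := @h2 a
      have hTa := @hT a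
      simp only [Finset.mem_sdiff, Finset.mem_univ, true_and, not_not, Finset.mem_union]
        at h1a h2a ⊢
      tauto
    · rintro rfl
      refine ⟨fun a => ?_, fun a => ?_⟩ <;>
        simp only [Finset.mem_sdiff, Finset.mem_univ, true_and, not_not, Finset.mem_union] <;> tauto
  simp only [h]

/-- A packet in state `S₁ ⊆ B` that is sent with `T ⊆ S₁` and leaves `S₁` either is received
outside `B` or moves to another state `S ⊆ B`. -/
lemma pCup_compl_eq_add_sum_fp {K : ℕ} (p : Finset (Fin K) → ℝ) {B S₁ T : Finset (Fin K)}
    (hT : T ⊆ S₁) (hB : S₁ ⊆ B) :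
    pCup p (Finset.univ \ S₁) = pCup p (Finset.univ \ B) +
      ∑ S ∈ B.powerset, if T ⊆ S ∧ ¬ S ⊆ S₁ then fp p (S \ T) (Finset.univ \ S) else 0 := by
  have h : ∀ S ∈ B.powerset,
      (if T ⊆ S ∧ ¬ S ⊆ S₁ then fp p (S \ T) (Finset.univ \ S) else 0) =
        ∑ Q : Finset (Fin K), if T ∪ Q = S then (if Q ⊆ S₁ then 0 else p Q) else 0 := by
    intro S _
    by_cases hS : T ⊆ S
    · rw [fp_sdiff_compl_eq p hS]
      by_cases hS' : S ⊆ S₁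
      · rw [if_neg (by tauto)]
        refine (Finset.sum_eq_zero fun Q _ => ?_).symm
        split_ifs with h1 h2
        · rfl
        · exact absurd (Finset.subset_union_right.trans (h1.subset.trans hS')) h2
        · rfl
      · rw [if_pos ⟨hS, hS'⟩]
        refine Finset.sum_congr rfl fun Q _ => ?_
        split_ifs with h1 h2
        · exact absurd (h1 ▸ Finset.union_subset hT h2) hS'
        · rfl
        · rfl
    · rw [if_neg (by tauto)]
      refine (Finset.sum_eq_zero fun Q _ => ?_).symm
      rw [if_neg]
      rintro rfl
      exact hS Finset.subset_union_left
  rw [Finset.sum_congr rfl h, Finset.sum_comm, pCup_compl_eq, pCup_compl_eq,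
    ← Finset.sum_add_distrib]
  refine Finset.sum_congr rfl fun Q _ => ?_
  rw [Finset.sum_ite_eq]
  have h2 : T ∪ Q ∈ B.powerset ↔ Q ⊆ B := by
    rw [Finset.mem_powerset, Finset.union_subset_iff]
    exact ⟨fun h => h.2, fun h => ⟨hT.trans hB, h⟩⟩
  simp only [h2]
  by_cases hQ : Q ⊆ B
  · simp [hQ]
  · have : ¬ Q ⊆ S₁ := fun h => hQ (h.trans hB)
    simp [hQ, this]

lemma fp_nonneg {K : ℕ} {p : Finset (Fin K) → ℝ} (hp : ∀ S, 0 ≤ p S) (S T : Finset (Fin K)) :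
    0 ≤ fp p S T :=
  Finset.sum_nonneg fun Q _ => hp Q

/-- The packets of session `k` stay in the states `S ⊆ B` for at least `R k / pCup p Bᶜ`
transmissions. -/
lemma LPFeasible.rate_le {K : ℕ} {p : Finset (Fin K) → ℝ} (hp : ∀ S, 0 ≤ p S)
    {R : Fin K → ℝ} {ord : Finset (Fin K) → Finset (Fin K) → Prop} {x : Finset (Fin K) → ℝ}
    {w : Fin K → Finset (Fin K) → Finset (Fin K) → ℝ} (hf : LPFeasible p R ord x w)
    {k : Fin K} {B : Finset (Fin K)} (hk : k ∉ B) :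
    R k ≤ (∑ S ∈ B.powerset, ∑ T ∈ S.powerset, w k S T) * pCup p (Finset.univ \ B) := by
  obtain ⟨-, hw, -, -, h3, h4, -⟩ := hf
  have hBk : ∀ {S : Finset (Fin K)}, S ⊆ B → S ⊆ Finset.univ \ {k} := fun {S} hS a ha => by
    simp only [Finset.mem_sdiff, Finset.mem_univ, Finset.mem_singleton, true_and]
    rintro rfl
    exact hk (hS ha)
  have key : ∀ S ∈ B.powerset, (if S = ∅ then R k else 0) +
      ∑ S₁ ∈ B.powerset, ∑ T ∈ S₁.powerset,
        w k S₁ T * (if T ⊆ S ∧ ¬ S ⊆ S₁ then fp p (S \ T) (Finset.univ \ S) else 0) ≤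
      ∑ T ∈ S.powerset, w k S T * pCup p (Finset.univ \ S) := by
    intro S hS
    rw [Finset.mem_powerset] at hS
    by_cases h0 : S = ∅
    · subst h0
      simpa using h3 k
    · rw [if_neg h0, zero_add, ← Finset.sum_mul]
      refine le_trans ?_ (h4 k S (hBk hS) (Finset.nonempty_iff_ne_empty.mpr h0))
      rw [Finset.sum_filter, Fintype.sum_prod_type]
      have hnn : ∀ S₁ T : Finset (Fin K),
          0 ≤ if T ⊆ S₁ ∧ S₁ ⊆ Finset.univ \ {k} ∧ T ⊆ S ∧ ¬ S ⊆ S₁ then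
            w k S₁ T * fp p (S \ T) (Finset.univ \ S) else 0 := by
        intro S₁ T
        split_ifs with h
        · exact mul_nonneg (hw k S₁ T h.1 h.2.1) (fp_nonneg hp _ _)
        · exact le_rfl
      refine le_trans (Finset.sum_le_sum fun S₁ hS₁ => ?_)
        (Finset.sum_le_univ_sum_of_nonneg fun S₁ => Finset.sum_nonneg fun T _ => hnn S₁ T)
      refine le_trans (Finset.sum_le_sum fun T hT => ?_)
        (Finset.sum_le_univ_sum_of_nonneg fun T => hnn S₁ T)
      rw [Finset.mem_powerset] at hS₁ hT
      simp only [hT, hBk hS₁, true_and, mul_ite, mul_zero, le_refl]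
  have total := Finset.sum_le_sum key
  rw [Finset.sum_add_distrib, Finset.sum_ite_eq' , if_pos (Finset.empty_mem_powerset B),
    Finset.sum_comm] at total
  have hin : ∑ S₁ ∈ B.powerset, ∑ S ∈ B.powerset, ∑ T ∈ S₁.powerset,
        w k S₁ T * (if T ⊆ S ∧ ¬ S ⊆ S₁ then fp p (S \ T) (Finset.univ \ S) else 0) =
      ∑ S₁ ∈ B.powerset, ∑ T ∈ S₁.powerset,
        (w k S₁ T * pCup p (Finset.univ \ S₁) - w k S₁ T * pCup p (Finset.univ \ B)) := by
    refine Finset.sum_congr rfl fun S₁ hS₁ => ?_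
    rw [Finset.sum_comm]
    refine Finset.sum_congr rfl fun T hT => ?_
    rw [← Finset.mul_sum, pCup_compl_eq_add_sum_fp p (Finset.mem_powerset.mp hT)
      (Finset.mem_powerset.mp hS₁)]
    ring
  rw [hin] at total
  simp only [Finset.sum_sub_distrib, ← Finset.sum_mul] at total ⊢
  linarith

/-- Charging every coding set to its minimal element in the order `π` bounds the total
coding time from below. -/
lemma LPFeasible.sum_time_le {K : ℕ} {p : Finset (Fin K) → ℝ}
    {R : Fin K → ℝ} {ord : Finset (Fin K) → Finset (Fin K) → Prop} {x : Finset (Fin K) → ℝ}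
    {w : Fin K → Finset (Fin K) → Finset (Fin K) → ℝ} (hf : LPFeasible p R ord x w)
    (π : Equiv.Perm (Fin K)) (B : Fin K → Finset (Fin K))
    (hB : ∀ j i, i ≤ j → π i ∉ B j) :
    ∑ j, ∑ S ∈ (B j).powerset, ∑ T ∈ S.powerset, w (π j) S T ≤ ∑ S, x S := by
  obtain ⟨hx, hw, -, h2, -⟩ := hf
  have hk : ∀ j, π j ∉ B j := fun j => hB j j le_rfl
  have step : ∀ j, ∑ S ∈ (B j).powerset, ∑ T ∈ S.powerset, w (π j) S T ≤
      ∑ U ∈ (B j).powerset, x (insert (π j) U) := by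
    intro j
    rw [Finset.sum_comm' (t' := (B j).powerset) (s' := fun T => (B j).powerset.filter (T ⊆ ·))]
    · refine Finset.sum_le_sum fun U hU => ?_
      rw [Finset.mem_powerset] at hU
      have h := h2 (insert (π j) U) (π j) (Finset.mem_insert_self _ _)
      have hsd : insert (π j) U \ {π j} = U := by
        rw [Finset.insert_sdiff_of_mem _ (Finset.mem_singleton_self _),
          Finset.sdiff_eq_self_of_disjoint (Finset.disjoint_singleton_right.mpr fun h => hk j (hU h))]
      rw [hsd] at h
      refine le_trans (Finset.sum_le_sum_of_subset_of_nonneg (fun S hS => ?_) ?_) h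
      · rw [Finset.mem_filter, Finset.mem_powerset] at hS
        rw [Finset.mem_filter, Finset.subset_sdiff, Finset.disjoint_singleton_right]
        exact ⟨Finset.mem_univ _, hS.2, Finset.subset_univ _, fun h => hk j (hS.1 h)⟩
      · intro S hS _
        rw [Finset.mem_filter] at hS
        exact hw _ _ _ hS.2.1 hS.2.2
    · intro S T
      simp only [Finset.mem_powerset, Finset.mem_filter]
      exact ⟨fun h => ⟨h, h.2.trans h.1⟩, fun h => h.1⟩
  refine (Finset.sum_le_sum fun j _ => step j).trans ?_
  rw [Finset.sum_sigma']
  have hinj : Set.InjOn (fun a : (_ : Fin K) × Finset (Fin K) => insert (π a.1) a.2)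
      (Finset.univ.sigma fun j => (B j).powerset : Finset ((_ : Fin K) × Finset (Fin K))) := by
    rintro ⟨i, U⟩ hU ⟨j, V⟩ hV h
    simp only [Finset.coe_sigma, Set.mem_sigma_iff, Finset.mem_coe, Finset.mem_univ, true_and,
      Finset.mem_powerset] at hU hV h
    have le_of : ∀ {i j : Fin K} {U V : Finset (Fin K)}, U ⊆ B i →
        insert (π i) U = insert (π j) V → i ≤ j := by
      intro i j U V hU h
      by_contra! hlt
      have hmem : π j ∈ insert (π i) U := h ▸ Finset.mem_insert_self _ _
      rcases Finset.mem_insert.mp hmem with h' | h'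
      · exact hlt.ne (π.injective h')
      · exact hB i j hlt.le (hU h')
    obtain rfl : i = j := le_antisymm (le_of hU h) (le_of hV h.symm)
    have hUV : U = V := by
      rw [← Finset.erase_insert fun h => hk i (hU h), h, Finset.erase_insert fun h => hk i (hV h)]
    rw [hUV]
  calc _ = ∑ T ∈ (Finset.univ.sigma fun j => (B j).powerset).image
          (fun a : (_ : Fin K) × Finset (Fin K) => insert (π a.1) a.2), x T :=
        (Finset.sum_image hinj).symm
    _ ≤ ∑ T, x T := Finset.sum_le_univ_sum_of_nonneg hx

/-- If there exist LP-feasible variables for a nonnegative rate vector `R` (with respect to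
some cardinality-compatible strict total order `ord`), then `R` satisfies all `K!`
outer-bound inequalities: the inner-bound region is contained in the outer-bound region. -/
theorem stmt11 (K : ℕ) (hK : 0 < K) (p : Finset (Fin K) → ℝ)
    (hp : ∀ S, 0 ≤ p S) (hsum : ∑ S : Finset (Fin K), p S = 1)
    (hpos : ∀ k : Fin K, 0 < pCup p {k})
    (R : Fin K → ℝ) (hR : ∀ k, 0 ≤ R k)
    (ord : Finset (Fin K) → Finset (Fin K) → Prop) (hord : CardCompatible ord)
    (hfeas : ∃ (x : Finset (Fin K) → ℝ) (w : Fin K → Finset (Fin K) → Finset (Fin K) → ℝ),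
      LPFeasible p R ord x w) :
    ∀ π : Equiv.Perm (Fin K),
      ∑ j : Fin K,
        R (π j) / pCup p ((Finset.univ.filter (fun i : Fin K => i ≤ j)).image π) ≤ 1 := by
  intro π
  obtain ⟨x, w, hf⟩ := hfeas
  let A : Fin K → Finset (Fin K) := fun j => (Finset.univ.filter (fun i : Fin K => i ≤ j)).image π
  have hA : ∀ j i, i ≤ j → π i ∈ A j := fun j i hij =>
    Finset.mem_image_of_mem π (Finset.mem_filter.mpr ⟨Finset.mem_univ i, hij⟩)
  have hB : ∀ j i, i ≤ j → π i ∉ Finset.univ \ A j := fun j i hij h =>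
    (Finset.mem_sdiff.mp h).2 (hA j i hij)
  have hApos : ∀ j, 0 < pCup p (A j) := fun j =>
    (hpos (π j)).trans_le <| Finset.sum_le_sum_of_subset_of_nonneg
      (fun S hS => by
        rw [Finset.mem_filter] at hS ⊢
        exact ⟨hS.1, hS.2.mono (Finset.inter_subset_inter_left
          (Finset.singleton_subset_iff.mpr (hA j j le_rfl)))⟩)
      fun S _ _ => hp S
  refine le_trans (Finset.sum_le_sum fun j _ => ?_)
    ((hf.sum_time_le π (fun j => Finset.univ \ A j) hB).trans hf.2.2.1.le)
  rw [div_le_iff₀ (hApos j)]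
  have h := hf.rate_le hp (hB j j le_rfl)
  rwa [Finset.sdiff_sdiff_eq_self (Finset.subset_univ _)] at h
end

section
/- Let K be a positive integer and consider a symmetric 1-to-K broadcast PEC with parameters p_S (S ⊆ [K]) such that p_k > 0 for every k ∈ [K]. Let (R_1,...,R_K) be a vector of nonnegative reals satisfying the strict outer-bound inequalities ∑_{j=1}^K R_{π(j)}/p_{∪S_j^π} < 1 for every permutation π of [K]. Then for every cardinality-compatible strict total order ≺ on the subsets of [K] there exist LP-feasible variables for (R_1,...,R_K) with respect to ≺. (This is the achievability core of the result that the outer bound is the capacity region for all symmetric 1-to-K broadcast PECs with channel output feedback.) -/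
open Finset
open scoped Classical

lemma pCup_univ_sdiff {K : ℕ} (p : Finset (Fin K) → ℝ) (S : Finset (Fin K)) :
    pCup p (univ \ S) = ∑ A, p A - ∑ A ∈ S.powerset, p A := by
  have h := Finset.sum_filter_add_sum_filter_not (univ : Finset (Finset (Fin K)))
    (fun A => (A ∩ (univ \ S)).Nonempty) p
  have h2 : (univ.filter fun A : Finset (Fin K) => ¬ (A ∩ (univ \ S)).Nonempty)
      = S.powerset := by
    ext A
    simp only [mem_filter, mem_univ, true_and, mem_powerset, not_nonempty_iff_eq_empty,
      Finset.eq_empty_iff_forall_notMem, mem_inter, mem_sdiff, not_and, not_not]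
    rfl
  rw [h2] at h
  unfold pCup
  linarith

lemma sum_fp_Icc {K : ℕ} (p : Finset (Fin K) → ℝ) {S T : Finset (Fin K)} (hTS : T ⊆ S) :
    ∑ U ∈ Icc T S, fp p (U \ T) (univ \ U) = ∑ A ∈ S.powerset, p A := by
  rw [← Finset.sum_fiberwise_of_maps_to (s := S.powerset) (t := Icc T S) (g := fun A => A ∪ T)]
  · refine Finset.sum_congr rfl fun U hU => ?_
    have hU' := Finset.mem_Icc.1 hU
    unfold fp
    refine Finset.sum_congr ?_ fun _ _ => rfl
    ext A
    simp only [mem_filter, mem_univ, true_and, mem_powerset]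
    constructor
    · rintro ⟨h1, h2⟩
      have h3 : A ⊆ U := fun a ha => by simpa using h2 ha
      refine ⟨h3.trans hU'.2, Finset.Subset.antisymm (union_subset h3 hU'.1) ?_⟩
      rw [union_comm]
      exact sdiff_le_iff.1 h1
    · rintro ⟨-, rfl⟩
      refine ⟨?_, fun a ha => by simp [ha]⟩
      refine sdiff_le_iff.2 ?_
      rw [sup_comm]
      exact le_rfl
  · intro A hA
    exact Finset.mem_Icc.2 ⟨subset_union_right, union_subset (mem_powerset.1 hA) hTS⟩

lemma pCup_nonneg {K : ℕ} {p : Finset (Fin K) → ℝ} (hp : ∀ S, 0 ≤ p S) (S : Finset (Fin K)) :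
    0 ≤ pCup p S :=
  Finset.sum_nonneg fun _ _ => hp _

lemma pCup_pos {K : ℕ} {p : Finset (Fin K) → ℝ} (hp : ∀ S, 0 ≤ p S)
    (hpos : ∀ k, 0 < pCup p {k}) {S : Finset (Fin K)} (hS : S.Nonempty) : 0 < pCup p S := by
  obtain ⟨k, hk⟩ := hS
  refine (hpos k).trans_le (Finset.sum_le_sum_of_subset_of_nonneg ?_ fun _ _ _ => hp _)
  intro A hA
  simp only [mem_filter, mem_univ, true_and] at hA ⊢
  exact hA.mono (inter_subset_inter_left (singleton_subset_iff.2 hk))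

lemma pCup_map {K : ℕ} {p : Finset (Fin K) → ℝ}
    (hsym : ∀ S T : Finset (Fin K), S.card = T.card → p S = p T)
    (σ : Equiv.Perm (Fin K)) (S : Finset (Fin K)) :
    pCup p (S.map σ.toEmbedding) = pCup p S := by
  unfold pCup
  symm
  refine Finset.sum_equiv σ.finsetCongr (fun A => ?_) fun A _ => hsym _ _ ?_
  · simp only [mem_filter, mem_univ, true_and, Equiv.finsetCongr_apply, ← map_inter,
      Finset.map_nonempty]
  · simp

/-- The expected number of slots for which a packet, retransmitted until every receiver has it,
has been received by exactly the receivers in `S`. -/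
noncomputable def stateTime {K : ℕ} (p : Finset (Fin K) → ℝ) (S : Finset (Fin K)) : ℝ :=
  ((if S = ∅ then 1 else 0) +
    ∑ T ∈ S.ssubsets.attach, stateTime p T.1 * fp p (S \ T.1) (univ \ S)) / pCup p (univ \ S)
termination_by S.card
decreasing_by exact card_lt_card (mem_ssubsets.1 T.2)

lemma stateTime_eq {K : ℕ} (p : Finset (Fin K) → ℝ) (S : Finset (Fin K)) :
    stateTime p S = ((if S = ∅ then 1 else 0) +
      ∑ T ∈ S.ssubsets, stateTime p T * fp p (S \ T) (univ \ S)) / pCup p (univ \ S) := by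
  rw [stateTime, Finset.sum_attach S.ssubsets
    (fun T => stateTime p T * fp p (S \ T) (univ \ S))]

lemma stateTime_nonneg {K : ℕ} {p : Finset (Fin K) → ℝ} (hp : ∀ S, 0 ≤ p S)
    (S : Finset (Fin K)) : 0 ≤ stateTime p S := by
  induction S using Finset.strongInduction with
  | H S ih =>
    rw [stateTime_eq]
    refine div_nonneg (add_nonneg (by split_ifs <;> norm_num) ?_) (pCup_nonneg hp _)
    exact Finset.sum_nonneg fun T hT => mul_nonneg (ih T (mem_ssubsets.1 hT)) (fp_nonneg hp _ _)

lemma univ_sdiff_nonempty {K : ℕ} {S : Finset (Fin K)} {k : Fin K} (hk : k ∉ S) :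
    (univ \ S).Nonempty :=
  ⟨k, by simp [hk]⟩

lemma stateTime_mul_pCup {K : ℕ} {p : Finset (Fin K) → ℝ} (hp : ∀ S, 0 ≤ p S)
    (hpos : ∀ k, 0 < pCup p {k}) {S : Finset (Fin K)} {k : Fin K} (hk : k ∉ S) :
    stateTime p S * pCup p (univ \ S) = (if S = ∅ then 1 else 0) +
      ∑ T ∈ S.ssubsets, stateTime p T * fp p (S \ T) (univ \ S) := by
  conv_lhs => rw [stateTime_eq]
  exact div_mul_cancel₀ _ (pCup_pos hp hpos (univ_sdiff_nonempty hk)).ne'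

lemma sum_powerset_stateTime {K : ℕ} {p : Finset (Fin K) → ℝ} (hp : ∀ S, 0 ≤ p S)
    (hpos : ∀ k, 0 < pCup p {k}) {S : Finset (Fin K)} {k : Fin K} (hk : k ∉ S) :
    ∑ T ∈ S.powerset, stateTime p T = 1 / pCup p (univ \ S) := by
  have hflow : ∑ U ∈ S.powerset, stateTime p U * pCup p (univ \ U) =
      1 + ∑ U ∈ S.powerset, ∑ T ∈ U.ssubsets, stateTime p T * fp p (U \ T) (univ \ U) := by
    rw [Finset.sum_congr rfl fun U hU =>
      stateTime_mul_pCup hp hpos fun h => hk (mem_powerset.1 hU h), Finset.sum_add_distrib]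
    simp
  have hswap : ∑ U ∈ S.powerset, ∑ T ∈ U.ssubsets, stateTime p T * fp p (U \ T) (univ \ U) =
      ∑ T ∈ S.powerset, ∑ U ∈ Ioc T S, stateTime p T * fp p (U \ T) (univ \ U) := by
    refine Finset.sum_comm' fun U T => ?_
    simp only [mem_powerset, mem_ssubsets, mem_Ioc]
    exact ⟨fun h => ⟨⟨h.2, h.1⟩, h.2.subset.trans h.1⟩, fun h => ⟨h.1.2, h.1.1⟩⟩
  have hstep : ∀ T ∈ S.powerset, ∑ U ∈ Ioc T S, stateTime p T * fp p (U \ T) (univ \ U) =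
      stateTime p T * pCup p (univ \ T) - stateTime p T * pCup p (univ \ S) := by
    intro T hT
    have hTS := mem_powerset.1 hT
    have h1 := sum_fp_Icc p hTS
    rw [← Finset.sum_Ioc_add_eq_sum_Icc (f := fun U => fp p (U \ T) (univ \ U))
      (show T ≤ S from hTS)] at h1
    have h2 := sum_fp_Icc p (Finset.Subset.refl T)
    rw [Icc_self, sum_singleton] at h2
    rw [← Finset.mul_sum, pCup_univ_sdiff p T, pCup_univ_sdiff p S]
    rw [h2] at h1
    linear_combination stateTime p T * h1
  rw [hswap, Finset.sum_congr rfl hstep, Finset.sum_sub_distrib, ← Finset.sum_mul] at hflow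
  rw [eq_div_iff (pCup_pos hp hpos (univ_sdiff_nonempty hk)).ne']
  linarith

lemma stateTime_map {K : ℕ} {p : Finset (Fin K) → ℝ} (hp : ∀ S, 0 ≤ p S)
    (hpos : ∀ k, 0 < pCup p {k})
    (hsym : ∀ S T : Finset (Fin K), S.card = T.card → p S = p T)
    (σ : Equiv.Perm (Fin K)) {S : Finset (Fin K)} {k : Fin K} (hk : k ∉ S) :
    stateTime p (S.map σ.toEmbedding) = stateTime p S := by
  induction S using Finset.strongInduction with
  | H S ih =>
    have h1 := sum_powerset_stateTime hp hpos hk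
    have h2 := sum_powerset_stateTime hp hpos (S := S.map σ.toEmbedding) (k := σ k)
      (by simpa using hk)
    have h3 : univ \ S.map σ.toEmbedding = (univ \ S).map σ.toEmbedding := by
      ext a; simp [mem_map_equiv]
    have h4 : ∑ T ∈ (S.map σ.toEmbedding).powerset, stateTime p T =
        ∑ T ∈ S.powerset, stateTime p (T.map σ.toEmbedding) := by
      symm
      refine Finset.sum_equiv σ.finsetCongr (fun A => ?_) fun A _ => rfl
      simp [Equiv.finsetCongr_apply]
    rw [h3, pCup_map hsym, ← h1, h4,
      ← Finset.sum_erase_add _ _ (mem_powerset_self S),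
      ← Finset.sum_erase_add (a := S) S.powerset (stateTime p) (mem_powerset_self S)] at h2
    have h5 : ∑ T ∈ S.powerset.erase S, stateTime p (T.map σ.toEmbedding) =
        ∑ T ∈ S.powerset.erase S, stateTime p T := by
      refine Finset.sum_congr rfl fun T hT => ?_
      have hTS : T ⊂ S := mem_ssubsets.1 hT
      exact ih T hTS fun h => hk (hTS.subset h)
    linarith

lemma stateTime_sdiff_singleton {K : ℕ} {p : Finset (Fin K) → ℝ} (hp : ∀ S, 0 ≤ p S)
    (hpos : ∀ k, 0 < pCup p {k})
    (hsym : ∀ S T : Finset (Fin K), S.card = T.card → p S = p T)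
    {T : Finset (Fin K)} {k l : Fin K} (hk : k ∈ T) (hl : l ∈ T) :
    stateTime p (T \ {l}) = stateTime p (T \ {k}) := by
  rw [← stateTime_map hp hpos hsym (Equiv.swap k l) (S := T \ {k}) (k := k) (by simp)]
  congr 1
  ext a
  simp only [mem_sdiff, mem_singleton, mem_map_equiv, Equiv.symm_swap, Equiv.swap_apply_def]
  split_ifs <;> grind

/-- For a symmetric 1-to-K broadcast PEC with positive marginal success probabilities, any
nonnegative rate vector satisfying all `K!` strict outer-bound inequalities admits
LP-feasible variables with respect to every cardinality-compatible strict total order: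
the achievability core of the result that the outer bound is the capacity region for all
symmetric 1-to-K broadcast PECs with channel output feedback. -/
theorem stmt13 (K : ℕ) (hK : 0 < K) (p : Finset (Fin K) → ℝ)
    (hp : ∀ S, 0 ≤ p S) (hsum : ∑ S : Finset (Fin K), p S = 1)
    (hsym : ∀ S1 S2 : Finset (Fin K), S1.card = S2.card → p S1 = p S2)
    (hpos : ∀ k : Fin K, 0 < pCup p {k})
    (R : Fin K → ℝ) (hR : ∀ k, 0 ≤ R k)
    (houter : ∀ π : Equiv.Perm (Fin K),
      ∑ j : Fin K,
        R (π j) / pCup p ((Finset.univ.filter (fun i : Fin K => i ≤ j)).image π) < 1) :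
    ∀ ord : Finset (Fin K) → Finset (Fin K) → Prop, CardCompatible ord →
      ∃ (x : Finset (Fin K) → ℝ) (w : Fin K → Finset (Fin K) → Finset (Fin K) → ℝ),
        LPFeasible p R ord x w := by
  rintro ord ⟨hord, hcard⟩
  obtain ⟨π, hπ⟩ : ∃ π : Equiv.Perm (Fin K), Antitone (R ∘ π) := by
    refine ⟨Tuple.sort (fun k => -R k), fun i j hij => ?_⟩
    simpa using Tuple.monotone_sort (fun k => -R k) hij
  have hc := stateTime_nonneg hp
  have hterm : ∀ (T : Finset (Fin K)) (j : Fin K),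
      0 ≤ if π j ∈ T ∧ ∀ i < j, π i ∉ T then R (π j) * stateTime p (T \ {π j}) else 0 := by
    intro T j
    split_ifs
    · exact mul_nonneg (hR _) (hc _)
    · exact le_rfl
  have hw : ∀ k (S T : Finset (Fin K)), 0 ≤ if T = S then R k * stateTime p S else 0 := by
    intro k S T
    split_ifs
    · exact mul_nonneg (hR _) (hc _)
    · exact le_rfl
  refine ⟨fun T => ∑ j, if π j ∈ T ∧ ∀ i < j, π i ∉ T then
      R (π j) * stateTime p (T \ {π j}) else 0,
    fun k S T => if T = S then R k * stateTime p S else 0,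
    fun T => Finset.sum_nonneg fun j _ => hterm T j, fun k S T _ _ => hw k S T,
    ?_, ?_, ?_, ?_, ?_⟩
  · rw [Finset.sum_comm]
    refine lt_of_eq_of_lt (Finset.sum_congr rfl fun j _ => ?_) (houter π)
    set J := (univ.filter fun i : Fin K => i ≤ j).image π with hJ
    have hjJ : π j ∈ J := by simp [hJ]
    have hmem : ∀ a, a ∈ J ↔ ∃ i ≤ j, π i = a := by simp [hJ]
    have hsub := sum_powerset_stateTime hp hpos (S := univ \ J) (k := π j) (by simp [hjJ])
    rw [Finset.sdiff_sdiff_eq_self (subset_univ J)] at hsub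
    rw [div_eq_mul_one_div, ← hsub, Finset.mul_sum, ← Finset.sum_filter]
    refine Finset.sum_bij' (fun T _ => T \ {π j}) (fun S _ => insert (π j) S) ?_ ?_ ?_ ?_ ?_
    · intro T hT
      simp only [mem_filter, mem_univ, true_and] at hT
      rw [mem_powerset]
      intro a ha
      simp only [mem_sdiff, mem_singleton, mem_univ, true_and, hmem] at ha ⊢
      rintro ⟨i, hi, rfl⟩
      rcases hi.lt_or_eq with h | rfl
      · exact hT.2 i h ha.1
      · exact ha.2 rfl
    · intro S hS
      have hS' := mem_powerset.1 hS
      simp only [mem_filter, mem_univ, true_and]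
      refine ⟨mem_insert_self _ _, fun i hi h => ?_⟩
      rcases mem_insert.1 h with h | h
      · exact hi.ne (π.injective h)
      · exact (mem_sdiff.1 (hS' h)).2 ((hmem _).2 ⟨i, hi.le, rfl⟩)
    · intro T hT
      simp only [mem_filter, mem_univ, true_and] at hT
      rw [sdiff_singleton_eq_erase, insert_erase hT.1]
    · intro S hS
      have hS' := mem_powerset.1 hS
      rw [sdiff_singleton_eq_erase, erase_insert]
      exact fun h => (mem_sdiff.1 (hS' h)).2 hjJ
    · intro T _
      rfl
  · intro T k hk
    obtain ⟨j, hj, hmin⟩ := WellFounded.has_min (wellFounded_lt (α := Fin K))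
      {j | π j ∈ T} ⟨π.symm k, by simpa using hk⟩
    have hle : R k ≤ R (π j) := by
      have h := hπ (not_lt.1 (hmin (π.symm k) (by simpa using hk)))
      simpa using h
    have hsingle := Finset.single_le_sum (fun j _ => hterm T j) (mem_univ j)
    rw [if_pos ⟨hj, fun i hi h => hmin i h hi⟩,
      stateTime_sdiff_singleton hp hpos hsym hk hj] at hsingle
    refine le_trans ?_ ((mul_le_mul_of_nonneg_right hle (hc _)).trans hsingle)
    rw [Finset.sum_ite_eq]
    split_ifs
    · exact le_rfl
    · exact mul_nonneg (hR _) (hc _)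
  · intro k
    have h := stateTime_mul_pCup hp hpos (notMem_empty k)
    have h0 : (∅ : Finset (Fin K)).ssubsets = ∅ := rfl
    rw [h0, sdiff_empty] at h
    simp only [if_true, sum_empty, add_zero] at h ⊢
    rw [mul_assoc, h, mul_one]
  · intro k S hS hne
    have hkS : k ∉ S := fun h => by simpa using hS h
    rw [Finset.sum_ite_eq', if_pos (mem_powerset_self S), mul_assoc,
      stateTime_mul_pCup hp hpos hkS, if_neg hne.ne_empty, zero_add, Finset.mul_sum]
    refine (Eq.symm ?_).le
    rw [← Finset.sum_subset (s₁ := S.ssubsets.image fun T => (T, T)),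
      Finset.sum_image (by simp)]
    · simp [mul_assoc]
    · intro ST h
      obtain ⟨T, hT, rfl⟩ := mem_image.1 h
      have hTS := mem_ssubsets.1 hT
      simpa using ⟨hTS.subset.trans hS, hTS.subset, hTS.not_subset⟩
    · rintro ⟨A, B⟩ h h'
      have hAB : B ≠ A := by
        rintro rfl
        simp only [mem_filter, mem_univ, true_and] at h
        exact h' (mem_image.2 ⟨B, mem_ssubsets.2 ⟨h.2.2.1, h.2.2.2⟩, rfl⟩)
      simp [hAB]
  · intro k S T hTS hS hne
    have hkS : k ∉ S := fun h => by simpa using hS h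
    have hkT : k ∉ T := fun h => hkS (hTS h)
    have hlt : (insert k T).card < (insert k S).card := by
      rw [card_insert_of_notMem hkT, card_insert_of_notMem hkS]
      exact Nat.succ_lt_succ (card_lt_card (hTS.ssubset_of_ne hne))
    have hnot : ¬ ord (insert k S) (insert k T) := fun h =>
      irrefl_of ord _ (trans_of ord h (hcard _ _ hlt))
    have hzero : ∑ T1 ∈ S.powerset.filter (fun T1 => ord (insert k T1) (insert k T)),
        (if T1 = S then R k * stateTime p S else 0) = 0 := by
      rw [Finset.sum_ite_eq', if_neg (by simp [hnot])]
    simp only [hzero, if_neg hne, add_zero, zero_mul]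
    exact add_nonneg
      (Finset.sum_nonneg fun _ _ => mul_nonneg (hw _ _ _) (fp_nonneg hp _ _))
      (Finset.sum_nonneg fun _ _ => mul_nonneg (hw _ _ _) (fp_nonneg hp _ _))
end

section
/- Let K be a positive integer and consider a spatially independent 1-to-K broadcast PEC with marginal success probabilities 0 < p_1 ≤ p_2 ≤ ... ≤ p_K ≤ 1. Let (R_1,...,R_K) be a one-sidedly fair vector of nonnegative reals satisfying the strict inequality ∑_{k=1}^K R_k/(1 − ∏_{l=1}^k (1−p_l)) < 1. Then for every cardinality-compatible strict total order ≺ on the subsets of [K] there exist LP-feasible variables for (R_1,...,R_K) with respect to ≺. (This is the achievability core of the result that, within the one-sidedly fair rate region, the capacity region of a spatially independent 1-to-K broadcast PEC with channel output feedback is characterized by the single inequality ∑_{k=1}^K R_k/(1 − ∏_{l=1}^k (1−p_l)) ≤ 1.) -/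
open Finset
open scoped Classical

/-- The probability that independent events with probabilities `u l` occur exactly for `l ∈ S`. -/
noncomputable def indepWeight {K : ℕ} (u : Fin K → ℝ) (S : Finset (Fin K)) : ℝ :=
  (∏ l ∈ S, u l) * ∏ l ∈ Sᶜ, (1 - u l)

theorem indepWeight_nonneg {K : ℕ} {u : Fin K → ℝ} (h0 : ∀ l, 0 ≤ u l) (h1 : ∀ l, u l ≤ 1)
    (S : Finset (Fin K)) : 0 ≤ indepWeight u S :=
  mul_nonneg (prod_nonneg fun l _ => h0 l) (prod_nonneg fun l _ => sub_nonneg.2 (h1 l))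

theorem indepWeight_eq_prod_ite {K : ℕ} (u : Fin K → ℝ) (S : Finset (Fin K)) :
    indepWeight u S = ∏ l, if l ∈ S then u l else 1 - u l := by
  rw [indepWeight, ← prod_mul_prod_compl S (fun l => if l ∈ S then u l else 1 - u l)]
  congr 1
  · exact prod_congr rfl fun l hl => by simp [hl]
  · exact prod_congr rfl fun l hl => by simp [mem_compl.1 hl]

theorem indepWeight_le {K : ℕ} {u : Fin K → ℝ} (h0 : ∀ l, 0 ≤ u l) (h1 : ∀ l, u l ≤ 1)
    {S : Finset (Fin K)} {k : Fin K} (hk : k ∉ S) : indepWeight u S ≤ 1 - u k := by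
  rw [indepWeight_eq_prod_ite, ← mul_prod_erase univ _ (mem_univ k), if_neg hk]
  refine mul_le_of_le_one_right (sub_nonneg.2 (h1 k)) (prod_le_one (fun l _ => ?_) fun l _ => ?_)
  · split_ifs
    · exact h0 l
    · exact sub_nonneg.2 (h1 l)
  · split_ifs
    · exact h1 l
    · linarith [h0 l]

theorem fp_indepWeight {K : ℕ} (u : Fin K → ℝ) {A B : Finset (Fin K)} (hAB : Disjoint A B) :
    fp (indepWeight u) A B = (∏ l ∈ A, u l) * ∏ l ∈ B, (1 - u l) := by
  have key := prod_add (fun l => if l ∈ B then 0 else u l)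
    (fun l => if l ∈ A then 0 else 1 - u l) univ
  have hterm : ∀ S : Finset (Fin K),
      (∏ l ∈ S, if l ∈ B then 0 else u l) * (∏ l ∈ univ \ S, if l ∈ A then 0 else 1 - u l)
        = if A ⊆ S ∧ S ⊆ univ \ B then indepWeight u S else 0 := by
    intro S
    split_ifs with h
    · rw [indepWeight, compl_eq_univ_sdiff]
      congr 1
      · exact prod_congr rfl fun l hl => if_neg (mem_sdiff.1 (h.2 hl)).2
      · exact prod_congr rfl fun l hl => if_neg fun hA => (mem_sdiff.1 hl).2 (h.1 hA)
    · rcases not_and_or.1 h with h | h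
      · obtain ⟨l, hA, hS⟩ := not_subset.1 h
        exact mul_eq_zero_of_right _ (prod_eq_zero (mem_sdiff.2 ⟨mem_univ l, hS⟩) (if_pos hA))
      · obtain ⟨l, hS, hB⟩ := not_subset.1 h
        have hlB : l ∈ B := by simpa using hB
        exact mul_eq_zero_of_left (prod_eq_zero hS (by simp [hlB])) _
  simp only [hterm, powerset_univ] at key
  rw [fp, sum_filter, ← key, ← prod_subset (subset_univ (A ∪ B)), prod_union hAB]
  · congr 1
    · refine prod_congr rfl fun l hl => ?_
      simp [hl, disjoint_left.1 hAB hl]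
    · refine prod_congr rfl fun l hl => ?_
      simp [hl, disjoint_right.1 hAB hl]
  · intro l _ hl
    simp only [mem_union, not_or] at hl
    simp [hl.1, hl.2]

theorem pCup_indepWeight {K : ℕ} (u : Fin K → ℝ) (A : Finset (Fin K)) :
    pCup (indepWeight u) A = 1 - ∏ l ∈ A, (1 - u l) := by
  have h0 := fp_indepWeight u (disjoint_empty_left (∅ : Finset (Fin K)))
  have hA := fp_indepWeight u (disjoint_empty_left A)
  have hsplit := sum_filter_add_sum_filter_not univ
    (fun S : Finset (Fin K) => (S ∩ A).Nonempty) (indepWeight u)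
  have hnot : ∀ S : Finset (Fin K), ¬ (S ∩ A).Nonempty ↔ ∅ ⊆ S ∧ S ⊆ univ \ A := by
    intro S
    rw [not_nonempty_iff_eq_empty, ← disjoint_iff_inter_eq_empty, ← compl_eq_univ_sdiff,
      subset_compl_iff_disjoint_right]
    simp
  simp only [hnot] at hsplit
  simp only [fp, prod_empty, one_mul, mul_one, empty_subset, sdiff_empty, subset_univ, and_self,
    true_and, filter_true] at h0 hA hsplit
  rw [pCup]
  linarith

/-- The probability that, after `t` independent transmissions with success probabilities `q`,
exactly the receivers in `S` have received the packet. -/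
noncomputable def heardProb {K : ℕ} (q : Fin K → ℝ) (t : ℕ) : Finset (Fin K) → ℝ :=
  indepWeight fun l => 1 - (1 - q l) ^ t

theorem heardProb_nonneg {K : ℕ} {q : Fin K → ℝ} (hq0 : ∀ k, 0 < q k) (hq1 : ∀ k, q k ≤ 1)
    (t : ℕ) (S : Finset (Fin K)) : 0 ≤ heardProb q t S :=
  indepWeight_nonneg
    (fun l => sub_nonneg.2 (pow_le_one₀ (sub_nonneg.2 (hq1 l)) (by linarith [hq0 l])))
    (fun l => sub_le_self _ (pow_nonneg (sub_nonneg.2 (hq1 l)) t)) S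

theorem summable_heardProb {K : ℕ} {q : Fin K → ℝ} (hq0 : ∀ k, 0 < q k) (hq1 : ∀ k, q k ≤ 1)
    {S : Finset (Fin K)} {k : Fin K} (hk : k ∉ S) :
    Summable fun t => heardProb q t S := by
  refine Summable.of_nonneg_of_le (fun t => heardProb_nonneg hq0 hq1 t S) (fun t => ?_)
    (summable_geometric_of_lt_one (sub_nonneg.2 (hq1 k)) (by linarith [hq0 k]))
  have := indepWeight_le (u := fun l => 1 - (1 - q l) ^ t)
    (fun l => sub_nonneg.2 (pow_le_one₀ (sub_nonneg.2 (hq1 l)) (by linarith [hq0 l])))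
    (fun l => sub_le_self _ (pow_nonneg (sub_nonneg.2 (hq1 l)) t)) hk
  simpa [heardProb] using this

theorem prod_one_sub_lt_one {K : ℕ} {q : Fin K → ℝ} (hq0 : ∀ k, 0 < q k) (hq1 : ∀ k, q k ≤ 1)
    {A : Finset (Fin K)} (hA : A.Nonempty) :
    ∏ l ∈ A, (1 - q l) < 1 := by
  obtain ⟨k, hk⟩ := hA
  rw [← mul_prod_erase A _ hk]
  refine lt_of_le_of_lt (mul_le_of_le_one_right (sub_nonneg.2 (hq1 k))
    (prod_le_one (fun l _ => sub_nonneg.2 (hq1 l)) fun l _ => ?_)) ?_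
  · linarith [hq0 l]
  · linarith [hq0 k]

theorem sum_tsum_heardProb {K : ℕ} {q : Fin K → ℝ} (hq0 : ∀ k, 0 < q k) (hq1 : ∀ k, q k ≤ 1)
    {B : Finset (Fin K)} (hB : B.Nonempty) :
    ∑ S ∈ univ.filter (fun S : Finset (Fin K) => S ⊆ univ \ B), ∑' t, heardProb q t S
      = (1 - ∏ l ∈ B, (1 - q l))⁻¹ := by
  obtain ⟨k, hk⟩ := hB
  rw [← Summable.tsum_finsetSum, ← tsum_geometric_of_lt_one
    (prod_nonneg fun l _ => sub_nonneg.2 (hq1 l)) (prod_one_sub_lt_one hq0 hq1 ⟨k, hk⟩)]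
  · refine tsum_congr fun t => ?_
    have h := fp_indepWeight (fun l => 1 - (1 - q l) ^ t) (disjoint_empty_left B)
    simpa [fp, heardProb, prod_pow] using h
  · intro S hS
    refine summable_heardProb hq0 hq1 (k := k) fun h => ?_
    simpa [hk] using (mem_filter.1 hS).2 h

theorem heardProb_succ {K : ℕ} {q : Fin K → ℝ} (t : ℕ) (S : Finset (Fin K)) :
    heardProb q (t + 1) S = ∑ T ∈ S.powerset,
      heardProb q t T * fp (indepWeight q) (S \ T) (univ \ S) := by
  have hS : ∏ l ∈ S, (1 - (1 - q l) ^ (t + 1))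
      = ∏ l ∈ S, ((1 - (1 - q l) ^ t) + (1 - q l) ^ t * q l) :=
    prod_congr rfl fun l _ => by ring
  rw [heardProb, indepWeight, hS, prod_add, sum_mul]
  refine sum_congr rfl fun T hT => ?_
  have hTS := mem_powerset.1 hT
  rw [fp_indepWeight q (disjoint_sdiff.mono_left sdiff_subset), heardProb, indepWeight]
  have hTc : Tᶜ = (S \ T) ∪ Sᶜ := by
    ext l
    have := @hTS l
    simp only [mem_compl, mem_union, mem_sdiff]
    tauto
  have hd : Disjoint (S \ T) Sᶜ := disjoint_compl_right.mono_left sdiff_subset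
  rw [hTc, prod_union hd, prod_mul_distrib, ← compl_eq_univ_sdiff]
  simp only [sub_sub_cancel, pow_succ, prod_mul_distrib]
  ring

theorem tsum_heardProb_balance {K : ℕ} {q : Fin K → ℝ} (hq0 : ∀ k, 0 < q k) (hq1 : ∀ k, q k ≤ 1)
    {S : Finset (Fin K)} {k : Fin K} (hk : k ∉ S)
    (hS : S.Nonempty) :
    (∑' t, heardProb q t S) * pCup (indepWeight q) (univ \ S)
      = ∑ T ∈ S.ssubsets, (∑' t, heardProb q t T) * fp (indepWeight q) (S \ T) (univ \ S) := by
  have hzero : heardProb q 0 S = 0 := by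
    obtain ⟨l, hl⟩ := hS
    rw [heardProb, indepWeight, prod_eq_zero hl (by simp), zero_mul]
  have hsum : ∀ T ∈ S.powerset, Summable fun t => heardProb q t T :=
    fun T hT => summable_heardProb hq0 hq1 (k := k) fun h => hk (mem_powerset.1 hT h)
  have hrec : ∑' t, heardProb q t S = ∑ T ∈ S.powerset,
      (∑' t, heardProb q t T) * fp (indepWeight q) (S \ T) (univ \ S) := by
    rw [(summable_heardProb hq0 hq1 hk).tsum_eq_zero_add, hzero, zero_add]
    simp only [heardProb_succ, ← tsum_mul_right]
    exact Summable.tsum_finsetSum fun T hT => (hsum T hT).mul_right _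
  have hstay : fp (indepWeight q) (S \ S) (univ \ S)
      = 1 - pCup (indepWeight q) (univ \ S) := by
    rw [pCup_indepWeight, fp_indepWeight q (disjoint_sdiff.mono_left sdiff_subset)]
    simp
  rw [← insert_erase (mem_powerset_self S), sum_insert (notMem_erase _ _), hstay] at hrec
  rw [ssubsets]
  linarith

theorem mul_heardProb_le {K : ℕ} {q : Fin K → ℝ} (hq0 : ∀ k, 0 < q k) (hq1 : ∀ k, q k ≤ 1)
    {R : Fin K → ℝ} (hR : ∀ k, 0 ≤ R k) {m k : Fin K} (hmk : m ≠ k)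
    (hq : q m ≤ q k) (hfair : R k * (1 - q k) ≤ R m * (1 - q m)) {T : Finset (Fin K)}
    (hm : m ∈ T) (hk : k ∈ T) (t : ℕ) :
    R k * heardProb q t (T \ {k}) ≤ R m * heardProb q t (T \ {m}) := by
  have hfactor : ∀ i j : Fin K, i ≠ j → j ∈ T → heardProb q t (T \ {i})
      = (1 - q i) ^ t * ((1 - (1 - q j) ^ t) * ∏ l ∈ (univ.erase i).erase j,
          if l ∈ T then 1 - (1 - q l) ^ t else (1 - q l) ^ t) := by
    intro i j hij hj
    rw [heardProb, indepWeight_eq_prod_ite, ← mul_prod_erase univ _ (mem_univ i),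
      ← mul_prod_erase (univ.erase i) _ (mem_erase.2 ⟨hij.symm, mem_univ j⟩)]
    congr 1
    · simp
    congr 1
    · simp [hj, hij.symm]
    · refine prod_congr rfl fun l hl => ?_
      have hli : l ≠ i := by simp at hl; tauto
      simp [hli]
  rw [hfactor k m hmk.symm hm, hfactor m k hmk hk, erase_right_comm]
  generalize hP : (∏ l ∈ (univ.erase m).erase k,
    if l ∈ T then 1 - (1 - q l) ^ t else (1 - q l) ^ t) = P
  have hP0 : 0 ≤ P := by
    rw [← hP]
    refine prod_nonneg fun l _ => ?_
    split_ifs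
    · exact sub_nonneg.2 (pow_le_one₀ (sub_nonneg.2 (hq1 l)) (by linarith [hq0 l]))
    · exact pow_nonneg (sub_nonneg.2 (hq1 l)) t
  cases t with
  | zero => simp
  | succ t =>
    have hak : 0 ≤ 1 - q k := sub_nonneg.2 (hq1 k)
    have ham : 0 ≤ 1 - q m := sub_nonneg.2 (hq1 m)
    have hle : 1 - q k ≤ 1 - q m := by linarith
    have hpow : R k * (1 - q k) ^ (t + 1) ≤ R m * (1 - q m) ^ (t + 1) := by
      calc R k * (1 - q k) ^ (t + 1) = R k * (1 - q k) * (1 - q k) ^ t := by ring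
        _ ≤ R m * (1 - q m) * (1 - q m) ^ t :=
          mul_le_mul hfair (pow_le_pow_left₀ hak hle t) (pow_nonneg hak t)
            (mul_nonneg (hR m) ham)
        _ = R m * (1 - q m) ^ (t + 1) := by ring
    have hmiss : 1 - (1 - q m) ^ (t + 1) ≤ 1 - (1 - q k) ^ (t + 1) :=
      sub_le_sub_left (pow_le_pow_left₀ hak hle _) 1
    have hmiss0 : 0 ≤ 1 - (1 - q m) ^ (t + 1) :=
      sub_nonneg.2 (pow_le_one₀ ham (by linarith [hq0 m]))
    rw [← mul_assoc (R k), ← mul_assoc (R m)]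
    exact mul_le_mul hpow (mul_le_mul_of_nonneg_right hmiss hP0) (mul_nonneg hmiss0 hP0)
      (mul_nonneg (hR m) (pow_nonneg ham _))

theorem sum_min_reindex {K : ℕ} (g : Finset (Fin K) → ℝ) (k : Fin K) :
    (∑ T : Finset (Fin K), if k ∈ T ∧ ∀ l ∈ T, k ≤ l then g (T \ {k}) else 0)
      = ∑ S ∈ univ.filter (fun S : Finset (Fin K) => S ⊆ univ \ univ.filter (· ≤ k)), g S := by
  rw [← sum_filter]
  refine sum_nbij' (· \ {k}) (insert k) ?_ ?_ ?_ ?_ ?_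
  · intro T hT
    simp only [mem_filter, mem_univ, true_and] at hT ⊢
    intro l hl
    simp only [mem_sdiff, mem_singleton] at hl
    simpa using lt_of_le_of_ne (hT.2 l hl.1) (Ne.symm hl.2)
  · intro S hS
    simp only [mem_filter, mem_univ, true_and] at hS ⊢
    refine ⟨mem_insert_self _ _, fun l hl => ?_⟩
    rcases mem_insert.1 hl with rfl | hl
    · exact le_rfl
    · have := hS hl
      simp at this
      exact this.le
  · intro T hT
    simp only [mem_filter, mem_univ, true_and] at hT
    rw [sdiff_singleton_eq_erase, insert_erase hT.1]
  · intro S hS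
    simp only [mem_filter, mem_univ, true_and] at hS
    rw [sdiff_singleton_eq_erase, erase_insert]
    intro hk
    simpa using hS hk
  · intro T _
    rfl

/-- For a spatially independent 1-to-K broadcast PEC with marginal success probabilities
`0 < q 1 ≤ ... ≤ q K ≤ 1`, any one-sidedly fair nonnegative rate vector satisfying the
strict inequality `∑_{k=1}^K R_k/(1 − ∏_{l=1}^k (1−q l)) < 1` admits LP-feasible variables
with respect to every cardinality-compatible strict total order: the achievability core of
the result that, within the one-sidedly fair rate region, the capacity region is
characterized by the single inequality `∑_{k=1}^K R_k/(1 − ∏_{l=1}^k (1−q l)) ≤ 1`. -/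
theorem stmt14 (K : ℕ) (hK : 0 < K) (p : Finset (Fin K) → ℝ) (q : Fin K → ℝ)
    (hq0 : ∀ k, 0 < q k) (hq1 : ∀ k, q k ≤ 1)
    (hmono : ∀ i j : Fin K, i ≤ j → q i ≤ q j)
    (hind : ∀ S : Finset (Fin K),
      p S = (∏ k ∈ S, q k) * ∏ k ∈ Sᶜ, (1 - q k))
    (R : Fin K → ℝ) (hR : ∀ k, 0 ≤ R k)
    (hosf : ∀ i j : Fin K, i ≠ j → q i ≤ q j → R j * (1 - q j) ≤ R i * (1 - q i))
    (hstrict : ∑ k : Fin K,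
        R k / (1 - ∏ l ∈ Finset.univ.filter (fun l : Fin K => l ≤ k), (1 - q l)) < 1) :
    ∀ ord : Finset (Fin K) → Finset (Fin K) → Prop, CardCompatible ord →
      ∃ (x : Finset (Fin K) → ℝ) (w : Fin K → Finset (Fin K) → Finset (Fin K) → ℝ),
        LPFeasible p R ord x w := by
  intro ord hord
  have := hord.1
  obtain rfl : p = indepWeight q := funext hind
  set N : Finset (Fin K) → ℝ := fun S => ∑' t, heardProb q t S with hN
  have hN0 : ∀ S, 0 ≤ N S := fun S => tsum_nonneg fun t => heardProb_nonneg hq0 hq1 t S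
  have hp0 : ∀ S, 0 ≤ indepWeight q S := indepWeight_nonneg (fun l => (hq0 l).le) hq1
  have hw0 : ∀ k S T, 0 ≤ (if S = T then R k * N S else 0 : ℝ) := by
    intro k S T
    split_ifs
    · exact mul_nonneg (hR k) (hN0 S)
    · exact le_rfl
  have hx0 : ∀ (k : Fin K) (T : Finset (Fin K)),
      0 ≤ (if k ∈ T ∧ ∀ l ∈ T, k ≤ l then R k * N (T \ {k}) else 0 : ℝ) := by
    intro k T
    split_ifs
    · exact mul_nonneg (hR k) (hN0 _)
    · exact le_rfl
  refine ⟨fun T => ∑ k, if k ∈ T ∧ ∀ l ∈ T, k ≤ l then R k * N (T \ {k}) else 0,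
    fun k S T => if S = T then R k * N S else 0,
    fun T => sum_nonneg fun k _ => hx0 k T, fun k S T _ _ => hw0 k S T, ?_, ?_, ?_, ?_, ?_⟩
  · rw [sum_comm]
    refine lt_of_eq_of_lt (sum_congr rfl fun k _ => ?_) hstrict
    rw [sum_min_reindex (fun S => R k * N S) k, ← mul_sum,
      sum_tsum_heardProb hq0 hq1 ⟨k, by simp⟩, div_eq_mul_inv]
  · intro T k hk
    have hmem : T \ {k} ∈ univ.filter
        (fun S : Finset (Fin K) => T \ {k} ⊆ S ∧ S ⊆ univ \ {k}) := by
      exact mem_filter.2 ⟨mem_univ _, Subset.refl _,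
        sdiff_subset_sdiff (subset_univ T) (Subset.refl {k})⟩
    rw [sum_ite_eq_of_mem' _ _ _ hmem]
    have hmT := T.min'_mem ⟨k, hk⟩
    have hmin : ∀ l ∈ T, T.min' ⟨k, hk⟩ ≤ l := fun l hl => T.min'_le l hl
    generalize T.min' ⟨k, hk⟩ = m at hmT hmin
    refine ge_trans (single_le_sum (fun i _ => hx0 i T) (mem_univ m)) ?_
    rw [if_pos ⟨hmT, hmin⟩]
    rcases eq_or_ne m k with rfl | hmk
    · exact le_rfl
    have hsummable : ∀ i : Fin K, Summable fun t => heardProb q t (T \ {i}) :=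
      fun i => summable_heardProb hq0 hq1 (k := i) (by simp)
    simp only [hN, ← tsum_mul_left, ge_iff_le]
    exact Summable.tsum_le_tsum
      (mul_heardProb_le hq0 hq1 hR hmk (hmono m k (hmin k hk))
        (hosf m k hmk (hmono m k (hmin k hk))) hmT hk)
      ((hsummable k).mul_left _) ((hsummable m).mul_left _)
  · intro k
    have hne : (univ : Finset (Fin K)).Nonempty := ⟨k, mem_univ k⟩
    have h := sum_tsum_heardProb hq0 hq1 hne
    have hpos := sub_pos.2 (prod_one_sub_lt_one hq0 hq1 hne)
    simp only [Finset.sdiff_self, subset_empty, filter_eq', mem_univ, if_true, sum_singleton] at h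
    simp only [if_true, pCup_indepWeight, hN, h]
    rw [mul_assoc, inv_mul_cancel₀ hpos.ne', mul_one]
  · intro k S hS hne
    have hk : k ∉ S := fun h => by simpa using hS h
    rw [sum_ite_eq_of_mem _ _ _ (mem_powerset_self S), mul_assoc,
      tsum_heardProb_balance hq0 hq1 hk hne, mul_sum]
    refine le_of_eq ?_
    simp only [ite_mul, zero_mul]
    rw [← sum_filter, filter_filter]
    refine sum_nbij' Prod.snd (fun T => (T, T)) ?_ ?_ ?_ ?_ ?_
    · rintro ⟨S1, T1⟩ h
      simp only [mem_filter, mem_univ, true_and] at h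
      obtain ⟨⟨-, -, h1, h2⟩, rfl⟩ := h
      exact mem_ssubsets.2 ⟨h1, h2⟩
    · intro T hT
      obtain ⟨h1, h2⟩ := mem_ssubsets.1 hT
      simpa using ⟨h1.trans hS, h1, h2⟩
    · rintro ⟨S1, T1⟩ h
      exact Prod.ext (mem_filter.1 h).2.2.symm rfl
    · intro T _
      rfl
    · rintro ⟨S1, T1⟩ h
      obtain rfl : S1 = T1 := (mem_filter.1 h).2.2
      exact mul_assoc _ _ _
  · intro k S T hTS hS hne
    have hk : k ∉ S := fun h => by simpa using hS h
    have hcard : (insert k T).card < (insert k S).card := by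
      rw [card_insert_of_notMem hk, card_insert_of_notMem fun h => hk (hTS h)]
      exact Nat.add_lt_add_right (card_lt_card (hTS.ssubset_of_ne hne)) 1
    have hnot : ¬ ord (insert k S) (insert k T) := fun h =>
      irrefl_of ord _ (trans_of ord h (hord.2 _ _ hcard))
    have hzero : ∑ T1 ∈ S.powerset.filter (fun T1 => ord (insert k T1) (insert k T)),
        (if S = T1 then R k * N S else 0 : ℝ) = 0 := by
      refine sum_eq_zero fun T1 hT1 => if_neg ?_
      rintro rfl
      exact hnot (mem_filter.1 hT1).2
    simp only [hzero, if_neg (Ne.symm hne), add_zero, zero_mul]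
    have hfp : ∀ A B, 0 ≤ fp (indepWeight q) A B := fun A B => sum_nonneg fun _ _ => hp0 _
    exact add_nonneg (sum_nonneg fun _ _ => mul_nonneg (hw0 _ _ _) (hfp _ _))
      (sum_nonneg fun _ _ => mul_nonneg (hw0 _ _ _) (hfp _ _))
end
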